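/- Let (W,S) be a Coxeter system and J ⊆ I ⊆ S. The following are equivalent: (1) every generator in J commutes with every generator in I∖J; (2) every element of W_{I∖J} commutes with every element of W_J; (3) W_J is a normal subgroup of W_I; (4) W_{I∖J} is a normal subgroup of W_I; (5) every element of W_I can be written uniquely as a product of an element of W_{I∖J} and an element of W_J. -/

import Mathlib

/-- The standard parabolic subgroup generated by the simple reflections in `I`. -/
def parabolic {B W : Type*} [Group W] {M : CoxeterMatrix B} (cs : CoxeterSystem M W)
    (I : Set B) : Subgroup W :=
  Subgroup.closure (cs.simple '' I)

open Real Module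

noncomputable section

namespace CoxAux

variable {B W : Type*} [Group W] {M : CoxeterMatrix B} (cs : CoxeterSystem M W)

/-- Twice the entry of the Gram matrix. -/
def gram (M : CoxeterMatrix B) (i j : B) : ℝ := -2 * Real.cos (π / M i j)

lemma gram_self (i : B) : gram M i i = 2 := by simp [gram]

lemma gram_symm (i j : B) : gram M i j = gram M j i := by
  simp [gram, M.symmetric i j]

/-- The geometric representation space. -/
abbrev V (B : Type*) := B →₀ ℝ

/-- simple root -/
def rt (i : B) : V B := Finsupp.single i 1

/-- simple coroot -/
def crt (M : CoxeterMatrix B) (i : B) : Dual ℝ (V B) :=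
  Finsupp.linearCombination ℝ (fun j => gram M i j)

lemma crt_rt (i j : B) : crt M i (rt j) = gram M i j := by
  simp [crt, rt]

lemma crt_self (i : B) : crt M i (rt i) = 2 := by rw [crt_rt, gram_self]

/-- simple reflection -/
def refl (M : CoxeterMatrix B) (i : B) : V B ≃ₗ[ℝ] V B := reflection (crt_self (M := M) i)

lemma refl_apply (i : B) (x : V B) : refl M i x = x - crt M i x • rt i := reflection_apply _ _

lemma gram_eq_zero {i j : B} (h : gram M i j = 0) : M i j = 2 := by
  have h1 : Real.cos (π / M i j) = 0 := by simpa [gram] using h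
  have hp := Real.pi_pos
  rcases Nat.lt_or_ge 2 (M i j) with h2 | h2
  · exfalso
    have h3 : (2:ℝ) < M i j := by exact_mod_cast h2
    have : 0 < Real.cos (π / M i j) := by
      apply Real.cos_pos_of_mem_Ioo
      constructor
      · have : 0 < π / M i j := by positivity
        linarith
      · gcongr
    linarith
  · interval_cases h4 : M i j
    · simp at h1
    · simp at h1
    · rfl

lemma S_eval (ψ : ℝ) (n : ℤ) :
    (Polynomial.Chebyshev.S ℝ n).eval (2 * Real.cos ψ) * Real.sin ψ = Real.sin ((n + 1) * ψ) := by
  rw [← Polynomial.Chebyshev.U_real_cos, ← Polynomial.Chebyshev.S_comp_two_mul_X]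
  simp

lemma refl_liftable : M.IsLiftable (refl M) := by
  intro i j
  have hp := Real.pi_pos
  by_cases hm0 : M i j = 0
  · simp [hm0]
  by_cases hm1 : M i j = 1
  · have : i = j := by
      by_contra hij
      exact M.off_diagonal i j hij hm1
    subst this
    ext1 x
    rw [hm1, pow_one, LinearEquiv.mul_apply]
    exact involutive_reflection (crt_self (M := M) i) x
  by_cases hm2 : M i j = 2
  · have h0 : gram M i j = 0 := by simp [gram, hm2]
    have h0' : gram M j i = 0 := by rw [gram_symm, h0]
    ext1 x
    rw [hm2, pow_two]
    simp only [LinearEquiv.mul_apply, refl_apply, map_sub, map_smul, crt_rt, h0, h0', gram_self,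
      LinearEquiv.coe_one, id]
    module
  have hm3 : 3 ≤ M i j := by omega
  obtain ⟨ψ, hψ⟩ : ∃ ψ : ℝ, ψ = 2 * (π / M i j) := ⟨_, rfl⟩
  have hm3' : (3:ℝ) ≤ M i j := by exact_mod_cast hm3
  have hmψ : (M i j : ℝ) * ψ = 2 * π := by rw [hψ]; field_simp
  have hsin : Real.sin ψ ≠ 0 := by
    apply ne_of_gt
    apply Real.sin_pos_of_pos_of_lt_pi
    · rw [hψ]; positivity
    · by_contra hcon
      nlinarith
  have ht : 2 * Real.cos ψ = crt M i (rt j) * crt M j (rt i) - 2 := by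
    rw [crt_rt, crt_rt, gram_symm j i, hψ, Real.cos_two_mul, gram]; ring
  ext1 x
  have key := reflection_mul_reflection_pow_apply (crt_self (M := M) i) (crt_self (M := M) j)
    (M i j) x (2 * Real.cos ψ) ht
  change ((reflection (crt_self (M := M) i) * reflection (crt_self (M := M) j)) ^ M i j) x = x
  rw [key]
  generalize hm : M i j = m at *
  rcases Nat.even_or_odd' m with ⟨k, hk | hk⟩
  · have e1 : ((m : ℤ) - 2) / 2 = (k:ℤ) - 1 := by omega
    have e2 : ((m : ℤ) - 1) / 2 = (k:ℤ) - 1 := by omega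
    have hS : (Polynomial.Chebyshev.S ℝ ((k:ℤ) - 1)).eval (2 * Real.cos ψ) = 0 := by
      apply mul_right_cancel₀ hsin
      rw [S_eval, zero_mul]
      have : (((k:ℤ) - 1 : ℤ) + 1 : ℝ) * ψ = π := by
        push_cast; subst hk; push_cast at hmψ; linarith
      rw [this, Real.sin_pi]
    rw [e1, e2, hS]; simp
  · have e1 : ((m : ℤ) - 2) / 2 = (k:ℤ) - 1 := by omega
    have e2 : ((m : ℤ) - 1) / 2 = (k:ℤ) := by omega
    have e3 : ((m : ℤ) - 3) / 2 = (k:ℤ) - 1 := by omega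
    have e4 : (m : ℤ) / 2 = (k:ℤ) := by omega
    have hS : (Polynomial.Chebyshev.S ℝ (k:ℤ)).eval (2 * Real.cos ψ) +
        (Polynomial.Chebyshev.S ℝ ((k:ℤ) - 1)).eval (2 * Real.cos ψ) = 0 := by
      apply mul_right_cancel₀ hsin
      rw [add_mul, S_eval, S_eval, zero_mul]
      have : (((k:ℤ) - 1 : ℤ) + 1 : ℝ) * ψ = 2 * π - ((k:ℤ) + 1 : ℝ) * ψ := by
        push_cast; subst hk; push_cast at hmψ; linarith
      rw [this, Real.sin_two_pi_sub]; ring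
    rw [e1, e2, e3, e4, hS]; simp

/-- geometric representation -/
def rho : W →* (V B ≃ₗ[ℝ] V B) := cs.lift ⟨refl M, refl_liftable⟩

lemma rho_simple (i : B) (x : V B) : rho cs (cs.simple i) x = x - crt M i x • rt i := by
  rw [rho, cs.lift_apply_simple, refl_apply]

/-- span of the roots in `J` -/
abbrev VJ (J : Set B) : Submodule ℝ (V B) := Finsupp.supported ℝ ℝ J

lemma rt_mem {i : B} {J : Set B} (h : i ∈ J) : rt i ∈ VJ J := Finsupp.single_mem_supported ℝ _ h

lemma VJ_disj {J K : Set B} (h : Disjoint J K) {x : V B} (hJ : x ∈ VJ J) (hK : x ∈ VJ K) :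
    x = 0 := by
  have := Finsupp.disjoint_supported_supported (M := ℝ) (R := ℝ) h
  exact (Submodule.disjoint_def.1 this) x hJ hK

lemma rho_sub_mem {J : Set B} {w : W} (hw : w ∈ parabolic cs J) :
    ∀ x, rho cs w x - x ∈ VJ J := by
  induction hw using Subgroup.closure_induction with
  | mem w h =>
    obtain ⟨i, hi, rfl⟩ := h
    intro x
    rw [rho_simple]
    have := (VJ J).smul_mem (-(crt M i x)) (rt_mem hi)
    convert this using 1
    module
  | one => intro x; simp
  | mul a b _ _ ha hb =>
    intro x
    rw [map_mul, LinearEquiv.mul_apply]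
    have := (VJ J).add_mem (ha (rho cs b x)) (hb x)
    convert this using 1
    abel
  | inv a _ ha =>
    intro x
    have := (VJ J).neg_mem (ha (rho cs a⁻¹ x))
    rw [← LinearEquiv.mul_apply, ← map_mul] at this
    simpa using this

lemma simple_not_mem {J K : Set B} (h : Disjoint J K) (i : B)
    (hJ : cs.simple i ∈ parabolic cs J) (hK : cs.simple i ∈ parabolic cs K) : False := by
  have := VJ_disj h (rho_sub_mem cs hJ (rt i)) (rho_sub_mem cs hK (rt i))
  rw [rho_simple, crt_self] at this
  have := DFunLike.congr_fun this i
  simp [rt] at this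

/-- bilinear form -/
def bil (M : CoxeterMatrix B) : V B →ₗ[ℝ] Dual ℝ (V B) :=
  Finsupp.linearCombination ℝ (fun j => crt M j)

lemma bil_rt (i : B) (x : V B) : bil M (rt i) x = crt M i x := by
  simp [bil, rt]

lemma bil_rt' (i : B) (x : V B) : bil M x (rt i) = crt M i x := by
  induction x using Finsupp.induction_linear with
  | zero => simp
  | add f g hf hg => simp [hf, hg]
  | single a b =>
    have : (Finsupp.single a b : V B) = b • rt a := by simp [rt]
    rw [this]
    simp only [map_smul, LinearMap.smul_apply, bil_rt, crt_rt, gram_symm a i]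

lemma bil_inv (w : W) : ∀ x y, bil M (rho cs w x) (rho cs w y) = bil M x y := by
  induction w using cs.simple_induction with
  | simple i =>
    intro x y
    simp only [rho_simple, map_sub, map_smul, LinearMap.sub_apply, LinearMap.smul_apply, bil_rt,
      bil_rt', crt_self, smul_eq_mul]
    ring
  | one => simp
  | mul a b ha hb =>
    intro x y
    simp only [map_mul, LinearEquiv.mul_apply, ha, hb]

lemma comm_of_gram {i j : B} (h : gram M i j = 0) :
    cs.simple i * cs.simple j = cs.simple j * cs.simple i := by
  have h1 := cs.simple_mul_simple_pow i j
  rw [gram_eq_zero h, pow_two] at h1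
  have := eq_inv_of_mul_eq_one_left h1
  simpa using this

lemma gram_of_conj {J : Set B} {s t : B} (ht : t ∉ J) (hs : s ∈ J)
    (h : cs.simple t * cs.simple s * (cs.simple t)⁻¹ ∈ parabolic cs J) : gram M s t = 0 := by
  have h1 := rho_sub_mem cs h (rho cs (cs.simple t) (rt s))
  simp only [← LinearEquiv.mul_apply, ← map_mul, inv_mul_cancel_right] at h1
  simp only [map_mul, LinearEquiv.mul_apply, rho_simple, map_sub, map_smul, crt_rt,
    gram_self] at h1
  have hst : s ≠ t := fun h => ht (h ▸ hs)
  have h2 := (Finsupp.mem_supported' ℝ _).1 h1 t ht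
  simp [rt, hst, gram_symm t s] at h2
  linarith

lemma gram_of_fact {J K : Set B} (hd : Disjoint K J) {s t : B} (hs : s ∈ J) (ht : t ∈ K)
    {u v : W} (hu : u ∈ parabolic cs K) (hv : v ∈ parabolic cs J)
    (h : cs.simple s * cs.simple t = u * v) : gram M s t = 0 := by
  have hv' : v = u⁻¹ * (cs.simple s * cs.simple t) := by rw [h]; group
  have h1 := rho_sub_mem cs hv (rt t)
  have h2 := rho_sub_mem cs (inv_mem hu) (rho cs (cs.simple s * cs.simple t) (rt t))
  rw [← LinearEquiv.mul_apply, ← map_mul, ← hv', map_mul, LinearEquiv.mul_apply, rho_simple cs t,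
    map_sub, map_smul, crt_self, rho_simple cs s, crt_rt] at h2
  have h3 : rho cs v (rt t) - rt t - gram M s t • rt s = 0 := by
    apply VJ_disj hd
    · have := (VJ K).add_mem h2 ((VJ K).smul_mem (-2) (rt_mem ht))
      convert this using 1
      module
    · exact sub_mem h1 ((VJ J).smul_mem _ (rt_mem hs))
  have h4 : rho cs v (rt t) = rt t + gram M s t • rt s := by
    rw [sub_sub, sub_eq_zero] at h3; exact h3
  have h5 := bil_inv cs v (rt t) (rt t)
  rw [h4] at h5
  simp only [map_add, map_smul, LinearMap.add_apply, LinearMap.smul_apply, bil_rt, crt_rt,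
    gram_self, smul_eq_mul, gram_symm t s] at h5
  nlinarith

/-! ### The permutation representation -/

open Classical in
/-- indicator -/
def ind (a b : W) : ZMod 2 := if a = b then 1 else 0

/-- action of the simple reflection -/
def act (i : B) : Function.End (W × ZMod 2) := fun p =>
  (cs.simple i * p.1 * cs.simple i, p.2 + ind p.1 (cs.simple i))

lemma ind_congr {a b c d : W} (h : a = b ↔ c = d) : ind a b = ind c d := by
  unfold ind
  by_cases h1 : a = b
  · rw [if_pos h1, if_pos (h.1 h1)]
  · rw [if_neg h1, if_neg (fun h2 => h1 (h.2 h2))]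

lemma act_pow (i j : B) (n : ℕ) (x : W) (e : ZMod 2) :
    ((act cs i * act cs j) ^ n) (x, e) =
      ((cs.simple i * cs.simple j) ^ n * x * ((cs.simple i * cs.simple j) ^ n)⁻¹,
        e + ∑ k ∈ Finset.range (2 * n), ind x ((cs.simple j * cs.simple i) ^ k * cs.simple j)) := by
  induction n with
  | zero => simp; rfl
  | succ n ih =>
    rw [pow_succ']
    change act cs i (act cs j (((act cs i * act cs j) ^ n) (x, e))) = _
    rw [ih]
    have hinv : (cs.simple i * cs.simple j)⁻¹ = cs.simple j * cs.simple i := by simp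
    have hinv' : ((cs.simple i * cs.simple j) ^ n)⁻¹ = (cs.simple j * cs.simple i) ^ n := by
      rw [← inv_pow, hinv]
    have hsw : ∀ k, (cs.simple j * cs.simple i) ^ k * cs.simple j =
        cs.simple j * (cs.simple i * cs.simple j) ^ k := by
      intro k
      induction k with
      | zero => simp
      | succ k ihk => rw [pow_succ', pow_succ', mul_assoc, ihk]; simp only [mul_assoc]
    have hp : (cs.simple i * cs.simple j) ^ n = ((cs.simple j * cs.simple i) ^ n)⁻¹ := by
      rw [← hinv', inv_inv]
    unfold act
    refine Prod.ext ?_ ?_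
    · simp only [pow_succ' _ n, mul_inv_rev, cs.inv_simple, mul_assoc]
    · simp only
      rw [show 2 * (n + 1) = 2 * n + 1 + 1 by ring, Finset.sum_range_succ, Finset.sum_range_succ]
      rw [← add_assoc, ← add_assoc]
      congr 1
      · congr 1
        apply ind_congr
        rw [hinv', two_mul, pow_add, mul_assoc _ _ (cs.simple j), hsw, hp]
        set q := (cs.simple j * cs.simple i) ^ n
        constructor
        · intro h; rw [← h]; group
        · rintro rfl; group
      · apply ind_congr
        have hq : (cs.simple j * cs.simple i) ^ (2 * n + 1) * cs.simple j =
            (cs.simple j * cs.simple i) ^ n * (cs.simple j * cs.simple i * cs.simple j) *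
              ((cs.simple j * cs.simple i) ^ n)⁻¹ := by
          rw [show 2 * n + 1 = (n + 1) + n by ring, pow_add, mul_assoc _ _ (cs.simple j), hsw, hp,
            pow_succ]
          simp only [mul_assoc]
        rw [hinv', hq, hp]
        generalize (cs.simple j * cs.simple i) ^ n = q
        constructor
        · intro h; rw [← h]; simp [mul_assoc]
        · rintro rfl; simp [mul_assoc]

lemma act_liftable : M.IsLiftable (act cs) := by
  intro i j
  funext p
  obtain ⟨x, e⟩ := p
  rw [act_pow, cs.simple_mul_simple_pow, two_mul, Finset.sum_range_add]
  have : (cs.simple j * cs.simple i) ^ M i j = 1 := cs.simple_mul_simple_pow' i j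
  simp only [pow_add, this, one_mul]
  rw [CharTwo.add_self_eq_zero]
  simp
  rfl

/-- permutation representation -/
def perm : W →* Function.End (W × ZMod 2) := cs.lift ⟨act cs, act_liftable cs⟩

lemma perm_word (ω : List B) (x : W) (e : ZMod 2) :
    perm cs (cs.wordProd ω) (x, e) =
      (cs.wordProd ω * x * (cs.wordProd ω)⁻¹, e + ((cs.rightInvSeq ω).map (ind x)).sum) := by
  induction ω with
  | nil => simp; rfl
  | cons i ω ih =>
    rw [cs.wordProd_cons, map_mul]
    change perm cs (cs.simple i) (perm cs (cs.wordProd ω) (x, e)) = _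
    rw [ih, perm, cs.lift_apply_simple]
    unfold act
    refine Prod.ext ?_ ?_
    · simp [mul_assoc]
    · simp only [CoxeterSystem.rightInvSeq, List.map_cons, List.sum_cons]
      rw [add_assoc, add_comm (List.sum _)]
      congr 2
      apply ind_congr
      generalize cs.wordProd ω = q
      constructor
      · intro h; rw [← h]; group
      · rintro rfl; group

lemma sum_ind_eq_zero {x : W} {L : List W} (h : x ∉ L) : (L.map (ind x)).sum = 0 := by
  induction L with
  | nil => simp
  | cons a L ih =>
    simp only [List.mem_cons, not_or] at h
    simp [ih h.2, ind, h.1]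

lemma exists_word {J : Set B} {w : W} (hw : w ∈ parabolic cs J) :
    ∃ ω : List B, (∀ i ∈ ω, i ∈ J) ∧ cs.wordProd ω = w := by
  induction hw using Subgroup.closure_induction with
  | mem w h =>
    obtain ⟨i, hi, rfl⟩ := h
    exact ⟨[i], by simpa using hi, by simp⟩
  | one => exact ⟨[], by simp, by simp⟩
  | mul a b _ _ ha hb =>
    obtain ⟨u, hu, rfl⟩ := ha
    obtain ⟨v, hv, rfl⟩ := hb
    refine ⟨u ++ v, ?_, cs.wordProd_append u v⟩
    intro i hi
    rcases List.mem_append.1 hi with h | h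
    · exact hu i h
    · exact hv i h
  | inv a _ ha =>
    obtain ⟨u, hu, rfl⟩ := ha
    exact ⟨u.reverse, by simpa using hu, cs.wordProd_reverse u⟩

lemma simple_mem {J : Set B} {i : B} (h : i ∈ J) : cs.simple i ∈ parabolic cs J :=
  Subgroup.subset_closure ⟨i, h, rfl⟩

lemma word_mem {J : Set B} (ω : List B) (h : ∀ i ∈ ω, i ∈ J) :
    cs.wordProd ω ∈ parabolic cs J := by
  induction ω with
  | nil => simp
  | cons i ω ih =>
    rw [cs.wordProd_cons]
    exact mul_mem (simple_mem cs (h i (by simp))) (ih fun j hj => h j (by simp [hj]))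

lemma ris_mem {J : Set B} (ω : List B) (h : ∀ i ∈ ω, i ∈ J) :
    ∀ x ∈ cs.rightInvSeq ω, x ∈ parabolic cs J := by
  induction ω with
  | nil => simp
  | cons i ω ih =>
    have h' : ∀ j ∈ ω, j ∈ J := fun j hj => h j (by simp [hj])
    intro x hx
    simp only [CoxeterSystem.rightInvSeq, List.mem_cons] at hx
    rcases hx with rfl | hx
    · have := word_mem cs ω h'
      exact mul_mem (mul_mem (inv_mem this) (simple_mem cs (h i (by simp)))) this
    · exact ih h' x hx

lemma last_mem {J : Set B} {ω : List B} {i : B} (hr : cs.IsReduced (ω.concat i))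
    (h : cs.wordProd (ω.concat i) ∈ parabolic cs J) : cs.simple i ∈ parabolic cs J := by
  by_contra hi
  obtain ⟨u, hu, hu'⟩ := exists_word cs h
  have h1 := perm_word cs (ω.concat i) (cs.simple i) 0
  rw [← hu', perm_word, sum_ind_eq_zero (fun h => hi (ris_mem cs u hu _ h))] at h1
  have h2 := congrArg Prod.snd h1
  have hn := hr.nodup_rightInvSeq
  rw [cs.rightInvSeq_concat, List.concat_eq_append] at hn
  rw [cs.rightInvSeq_concat, List.concat_eq_append, List.map_append, List.sum_append,
    sum_ind_eq_zero] at h2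
  · simp [ind] at h2
  · intro hmem
    exact (List.disjoint_of_nodup_append hn) hmem (by simp)

lemma inter_trivial {J K : Set B} (hd : Disjoint J K) {w : W} (hJ : w ∈ parabolic cs J)
    (hK : w ∈ parabolic cs K) : w = 1 := by
  obtain ⟨ω, hr, rfl⟩ := cs.exists_isReduced w
  rcases List.eq_nil_or_concat ω with rfl | ⟨u, i, rfl⟩
  · simp
  · exact (simple_not_mem cs hd i (last_mem cs hr hJ) (last_mem cs hr hK)).elim

lemma parabolic_mono {J K : Set B} (h : J ⊆ K) : parabolic cs J ≤ parabolic cs K :=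
  Subgroup.closure_mono (Set.image_mono h)

lemma comm_all {J K : Set B}
    (h : ∀ s ∈ J, ∀ t ∈ K, cs.simple s * cs.simple t = cs.simple t * cs.simple s) :
    ∀ u ∈ parabolic cs K, ∀ v ∈ parabolic cs J, u * v = v * u := by
  have h1 : parabolic cs K ≤ Subgroup.centralizer (parabolic cs J : Set W) := by
    unfold parabolic
    rw [Subgroup.centralizer_closure, Subgroup.closure_le]
    rintro _ ⟨t, ht, rfl⟩
    rw [SetLike.mem_coe, Subgroup.mem_centralizer_iff]
    rintro _ ⟨s, hs, rfl⟩
    exact h s hs t ht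
  intro u hu v hv
  exact (Subgroup.mem_centralizer_iff.1 (h1 hu) v hv).symm

lemma fact_exists {I J K : Set B} (hI : I ⊆ K ∪ J)
    (h : ∀ u ∈ parabolic cs K, ∀ v ∈ parabolic cs J, u * v = v * u) :
    ∀ w ∈ parabolic cs I, ∃ u ∈ parabolic cs K, ∃ v ∈ parabolic cs J, w = u * v := by
  intro w hw
  induction hw using Subgroup.closure_induction with
  | mem w hw =>
    obtain ⟨i, hi, rfl⟩ := hw
    rcases hI hi with h | h
    · exact ⟨_, simple_mem cs h, 1, one_mem _, by simp⟩
    · exact ⟨1, one_mem _, _, simple_mem cs h, by simp⟩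
  | one => exact ⟨1, one_mem _, 1, one_mem _, by simp⟩
  | mul a b _ _ ha hb =>
    obtain ⟨u, hu, v, hv, rfl⟩ := ha
    obtain ⟨u', hu', v', hv', rfl⟩ := hb
    refine ⟨u * u', mul_mem hu hu', v * v', mul_mem hv hv', ?_⟩
    have := h u' hu' v hv
    calc u * v * (u' * v') = u * (v * u') * v' := by group
      _ = u * (u' * v) * v' := by rw [this]
      _ = _ := by group
  | inv a _ ha =>
    obtain ⟨u, hu, v, hv, rfl⟩ := ha
    refine ⟨u⁻¹, inv_mem hu, v⁻¹, inv_mem hv, ?_⟩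
    rw [mul_inv_rev, h _ (inv_mem hu) _ (inv_mem hv)]

end CoxAux

end

/-- For `J ⊆ I ⊆ S` the five commutation/normality/factorization conditions are
equivalent. -/
theorem stmt3 {B W : Type*} [Group W] {M : CoxeterMatrix B} (cs : CoxeterSystem M W)
    (I J : Set B) (hJI : J ⊆ I) :
    List.TFAE [
      ∀ s ∈ J, ∀ t ∈ I \ J, cs.simple s * cs.simple t = cs.simple t * cs.simple s,
      ∀ u ∈ parabolic cs (I \ J), ∀ v ∈ parabolic cs J, u * v = v * u,
      parabolic cs J ≤ parabolic cs I ∧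
        ∀ g ∈ parabolic cs I, ∀ n ∈ parabolic cs J, g * n * g⁻¹ ∈ parabolic cs J,
      parabolic cs (I \ J) ≤ parabolic cs I ∧
        ∀ g ∈ parabolic cs I, ∀ n ∈ parabolic cs (I \ J), g * n * g⁻¹ ∈ parabolic cs (I \ J),
      ∀ w ∈ parabolic cs I, ∃! p : W × W,
        p.1 ∈ parabolic cs (I \ J) ∧ p.2 ∈ parabolic cs J ∧ w = p.1 * p.2 ] := by
  have hd : Disjoint (I \ J) J := Set.disjoint_sdiff_left
  have hI : I ⊆ (I \ J) ∪ J := by rw [Set.sdiff_union_of_subset hJI]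
  have hK : I \ J ⊆ I := Set.sdiff_subset
  tfae_have 1 → 2 := CoxAux.comm_all cs
  tfae_have 2 → 3 := by
    intro h
    refine ⟨CoxAux.parabolic_mono cs hJI, ?_⟩
    intro g hg n hn
    obtain ⟨u, hu, v, hv, rfl⟩ := CoxAux.fact_exists cs hI h g hg
    have h1 : v * n * v⁻¹ ∈ parabolic cs J := mul_mem (mul_mem hv hn) (inv_mem hv)
    have h2 : u * v * n * (u * v)⁻¹ = v * n * v⁻¹ := by
      calc u * v * n * (u * v)⁻¹ = u * (v * n * v⁻¹) * u⁻¹ := by group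
        _ = v * n * v⁻¹ := by rw [h u hu _ h1]; group
    rw [h2]; exact h1
  tfae_have 2 → 4 := by
    intro h
    refine ⟨CoxAux.parabolic_mono cs hK, ?_⟩
    intro g hg n hn
    obtain ⟨u, hu, v, hv, rfl⟩ := CoxAux.fact_exists cs hI h g hg
    have h2 : u * v * n * (u * v)⁻¹ = u * n * u⁻¹ := by
      calc u * v * n * (u * v)⁻¹ = u * (v * n) * v⁻¹ * u⁻¹ := by group
        _ = u * n * u⁻¹ := by rw [← h n hn v hv]; group
    rw [h2]; exact mul_mem (mul_mem hu hn) (inv_mem hu)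
  tfae_have 3 → 1 := by
    rintro ⟨-, h⟩ s hs t ht
    exact CoxAux.comm_of_gram cs (CoxAux.gram_of_conj cs ht.2 hs
      (h _ (CoxAux.simple_mem cs ht.1) _ (CoxAux.simple_mem cs hs)))
  tfae_have 4 → 1 := by
    rintro ⟨-, h⟩ s hs t ht
    exact (CoxAux.comm_of_gram cs (CoxAux.gram_of_conj cs (fun h => h.2 hs) ht
      (h _ (CoxAux.simple_mem cs (hJI hs)) _ (CoxAux.simple_mem cs ht)))).symm
  tfae_have 2 → 5 := by
    intro h w hw
    obtain ⟨u, hu, v, hv, rfl⟩ := CoxAux.fact_exists cs hI h w hw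
    refine ⟨(u, v), ⟨hu, hv, rfl⟩, ?_⟩
    rintro ⟨u', v'⟩ ⟨hu', hv', he⟩
    simp only at hu' hv' he
    have e1 : u'⁻¹ * u = v' * v⁻¹ := by
      rw [inv_mul_eq_iff_eq_mul, ← mul_assoc, ← he]; group
    have e2 : u'⁻¹ * u = 1 := CoxAux.inter_trivial cs hd (mul_mem (inv_mem hu') hu)
      (e1 ▸ mul_mem hv' (inv_mem hv))
    rw [e2] at e1
    have e3 : u' = u := inv_mul_eq_one.1 e2
    have e4 : v' = v := mul_inv_eq_one.1 e1.symm
    rw [e3, e4]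
  tfae_have 5 → 1 := by
    intro h s hs t ht
    obtain ⟨⟨u, v⟩, ⟨hu, hv, he⟩, -⟩ := h (cs.simple s * cs.simple t)
      (mul_mem (CoxAux.simple_mem cs (hJI hs)) (CoxAux.simple_mem cs ht.1))
    exact CoxAux.comm_of_gram cs (CoxAux.gram_of_fact cs hd hs ht hu hv he)
  tfae_finish
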